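/- arXiv:1707.03843 — 2 statements merged into one kernel-verified Lean document; each statement's English description precedes it below -/
import Mathlib

section
/- Let d ≥ 1 and N ≥ 1 be integers and let ℓ_1, …, ℓ_{d+1} be positive integers with ℓ_i ≤ N for all i and ℓ_i + ℓ_j ≥ N for all 1 ≤ i < j ≤ d+1. For all ν, μ ∈ H_{ℓ,N}^d, ⟨Q_ν(·;ℓ,N), Q_μ(·;ℓ,N)⟩_{ℓ,N} = B_ν(ℓ,N)·δ_{ν,μ}, where B_ν(ℓ,N) = [(−1)^{|ν|} (−|ℓ|)_{N+|ν|}] / [(−N)_{|ν|} (−|ℓ|)_N (−|ℓ|)_{2|ν|}] · ∏_{j=1}^d [(−ℓ_j+a_j)_{2ν_j} (−ℓ_j)_{ν_j} ν_j!] / [(−ℓ_j+a_j)_{ν_j} (a_j+1)_{ν_j}], with a_j = −|ℓ^{j+1}| + 2|ν^{j+1}| − 1. -/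
open Finset

noncomputable section

/-- Pochhammer symbol `(a)_n = a(a+1)⋯(a+n-1)`. -/
def poch (a : ℝ) (n : ℕ) : ℝ := ∏ k ∈ Finset.range n, (a + k)

/-- One-variable Hahn polynomial
`Q_n(x;a,b,M) = Σ_{k=0}^n (-n)_k (n+a+b+1)_k (-x)_k / ((a+1)_k (-M)_k k!)`. -/
def hahn1 (n : ℕ) (x a b M : ℝ) : ℝ :=
  ∑ k ∈ Finset.range (n + 1),
    poch (-(n : ℝ)) k * poch ((n : ℝ) + a + b + 1) k * poch (-x) k /
      (poch (a + 1) k * poch (-M) k * (Nat.factorial k : ℝ))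

/-- The discrete polyhedral domain `V_{ℓ,N}^d`. -/
def polyDomain (d N : ℕ) (ℓ : Fin (d + 1) → ℕ) : Finset (Fin d → ℕ) :=
  (Fintype.piFinset fun i : Fin d => Finset.range (ℓ i.castSucc + 1)).filter fun x =>
    N - ℓ (Fin.last d) ≤ ∑ i, x i ∧ ∑ i, x i ≤ N

/-- `|ν^{j+1}| = ν_{j+1} + ⋯ + ν_d` (1-indexed), for `j` corresponding to `j : Fin d`. -/
def tailSum (d : ℕ) (ν : Fin d → ℕ) (j : Fin d) : ℕ :=
  ∑ i ∈ Finset.univ.filter (fun i : Fin d => (j : ℕ) < (i : ℕ)), ν i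

/-- `|ℓ^{j+1}| = ℓ_{j+1} + ⋯ + ℓ_{d+1}` (1-indexed). -/
def tailSumL (d : ℕ) (ℓ : Fin (d + 1) → ℕ) (j : Fin d) : ℕ :=
  ∑ i ∈ Finset.univ.filter (fun i : Fin (d + 1) => (j : ℕ) < (i : ℕ)), ℓ i

/-- `|x_{j-1}| = x_1 + ⋯ + x_{j-1}` (1-indexed). -/
def headSum (d : ℕ) (x : Fin d → ℝ) (j : Fin d) : ℝ :=
  ∑ i ∈ Finset.univ.filter (fun i : Fin d => (i : ℕ) < (j : ℕ)), x i

/-- The parameter `a_j = -|ℓ^{j+1}| + 2|ν^{j+1}| - 1`. -/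
def aCoef (d : ℕ) (ℓ : Fin (d + 1) → ℕ) (ν : Fin d → ℕ) (j : Fin d) : ℝ :=
  -(tailSumL d ℓ j : ℝ) + 2 * (tailSum d ν j : ℝ) - 1

/-- The index set `H_{ℓ,N}^d`. -/
def indexSet (d N : ℕ) (ℓ : Fin (d + 1) → ℕ) : Set (Fin d → ℕ) :=
  {ν | (∑ i, ν i) ≤ N ∧ (∑ i, ν i) + N ≤ ∑ i, ℓ i ∧
    ∀ j : Fin d, ν j ≤ ℓ j.castSucc ∧ ν j + 2 * tailSum d ν j ≤ tailSumL d ℓ j}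

/-- The Hahn polynomial `Q_ν(x; ℓ, N)` on the polyhedron. -/
def hahnQ (d N : ℕ) (ℓ : Fin (d + 1) → ℕ) (ν : Fin d → ℕ) (x : Fin d → ℝ) : ℝ :=
  ((-1 : ℝ) ^ (∑ i, ν i) / poch (-(N : ℝ)) (∑ i, ν i)) *
    ∏ j : Fin d,
      poch (-(ℓ j.castSucc : ℝ)) (ν j) / poch (aCoef d ℓ ν j + 1) (ν j) *
        poch (-(N : ℝ) + headSum d x j + (tailSum d ν j : ℝ)) (ν j) *
        hahn1 (ν j) (x j) (-(ℓ j.castSucc : ℝ) - 1) (aCoef d ℓ ν j)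
          ((N : ℝ) - headSum d x j - (tailSum d ν j : ℝ))

/-- The weight function `H_{ℓ,N}` on `V_{ℓ,N}^d`. -/
def weightH (d N : ℕ) (ℓ : Fin (d + 1) → ℕ) (x : Fin d → ℕ) : ℝ :=
  (Nat.factorial N : ℝ) / poch (-((∑ i, ℓ i : ℕ) : ℝ)) N *
    ((∏ i : Fin d, poch (-(ℓ i.castSucc : ℝ)) (x i) / (Nat.factorial (x i) : ℝ)) *
      (poch (-(ℓ (Fin.last d) : ℝ)) (N - ∑ i, x i) /
        (Nat.factorial (N - ∑ i, x i) : ℝ)))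

/-- The inner product `⟨f,g⟩_{ℓ,N} = Σ_{x ∈ V_{ℓ,N}^d} f(x)g(x)H_{ℓ,N}(x)`. -/
def innerH (d N : ℕ) (ℓ : Fin (d + 1) → ℕ) (f g : (Fin d → ℕ) → ℝ) : ℝ :=
  ∑ x ∈ polyDomain d N ℓ, f x * g x * weightH d N ℓ x

/-- The norm `B_ν(ℓ, N)`. -/
def normB (d N : ℕ) (ℓ : Fin (d + 1) → ℕ) (ν : Fin d → ℕ) : ℝ :=
  ((-1 : ℝ) ^ (∑ i, ν i) * poch (-((∑ i, ℓ i : ℕ) : ℝ)) (N + ∑ i, ν i)) /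
    (poch (-(N : ℝ)) (∑ i, ν i) * poch (-((∑ i, ℓ i : ℕ) : ℝ)) N *
      poch (-((∑ i, ℓ i : ℕ) : ℝ)) (2 * ∑ i, ν i)) *
    ∏ j : Fin d,
      poch (-(ℓ j.castSucc : ℝ) + aCoef d ℓ ν j) (2 * ν j) *
          poch (-(ℓ j.castSucc : ℝ)) (ν j) * (Nat.factorial (ν j) : ℝ) /
        (poch (-(ℓ j.castSucc : ℝ) + aCoef d ℓ ν j) (ν j) *
          poch (aCoef d ℓ ν j + 1) (ν j))

theorem poch_zero (a : ℝ) : poch a 0 = 1 := by simp [poch]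

theorem poch_succ (a : ℝ) (n : ℕ) : poch a (n + 1) = poch a n * (a + n) := by
  simp [poch, Finset.prod_range_succ]

theorem poch_add (a : ℝ) (m n : ℕ) : poch a (m + n) = poch a m * poch (a + m) n := by
  unfold poch
  rw [Finset.prod_range_add]
  congr 1
  apply Finset.prod_congr rfl
  intro x _
  push_cast
  ring

theorem poch_vand (a b : ℝ) (n : ℕ) :
    ∑ p ∈ Finset.HasAntidiagonal.antidiagonal n, (n.choose p.1 : ℝ) * (poch a p.1 * poch b p.2)
      = poch (a + b) n := by
  induction n with
  | zero => simp [poch_zero]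
  | succ n ih =>
    have h := Finset.sum_antidiagonal_choose_succ_mul (R := ℝ) (fun i j => poch a i * poch b j) n
    rw [h, poch_succ, ← ih, Finset.sum_mul, ← Finset.sum_add_distrib]
    apply Finset.sum_congr rfl
    intro p hp
    rw [Finset.HasAntidiagonal.mem_antidiagonal] at hp
    have hc : n.choose p.2 = n.choose p.1 := by
      rw [← hp]; exact (Nat.choose_symm_add).symm
    have hn : (n : ℝ) = p.1 + p.2 := by rw [← hp]; push_cast; ring
    rw [hc, poch_succ, poch_succ, hn]
    ring

theorem poch_vand_range (a b : ℝ) (n : ℕ) :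
    ∑ k ∈ Finset.range (n + 1), (n.choose k : ℝ) * (poch a k * poch b (n - k))
      = poch (a + b) n := by
  rw [← poch_vand, Finset.Nat.sum_antidiagonal_eq_sum_range_succ_mk]

theorem poch_vand_div (a b : ℝ) (n : ℕ) :
    ∑ k ∈ Finset.range (n + 1), poch a k / (k.factorial : ℝ) *
      (poch b (n - k) / ((n - k).factorial : ℝ))
      = poch (a + b) n / (n.factorial : ℝ) := by
  rw [← poch_vand_range, Finset.sum_div]
  apply Finset.sum_congr rfl
  intro k hk
  have hk' : k ≤ n := by simpa [Nat.lt_succ_iff] using hk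
  have h := Nat.choose_mul_factorial_mul_factorial hk'
  have h' : (n.factorial : ℝ) = n.choose k * k.factorial * (n - k).factorial := by
    exact_mod_cast h.symm
  have h1 : (k.factorial : ℝ) ≠ 0 := by positivity
  have h2 : ((n - k).factorial : ℝ) ≠ 0 := by positivity
  have h3 : (n.choose k : ℝ) ≠ 0 := by
    have := Nat.choose_pos hk'
    positivity
  rw [h']
  field_simp

theorem poch_reflect (a : ℝ) (m : ℕ) : poch a m = (-1) ^ m * poch (1 - a - m) m := by
  unfold poch
  rw [← Finset.prod_range_reflect]
  have : ((-1 : ℝ) ^ m) = ∏ k ∈ Finset.range m, (-1 : ℝ) := by simp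
  rw [this, ← Finset.prod_mul_distrib]
  apply Finset.prod_congr rfl
  intro k hk
  have hk : k < m := by simpa using hk
  rw [Nat.sub_sub, Nat.cast_sub (by omega)]
  push_cast
  ring

theorem poch_cv (a c : ℝ) (n : ℕ) :
    ∑ k ∈ Finset.range (n + 1), (n.choose k : ℝ) * ((-1) ^ k * poch a k * poch (c + k) (n - k))
      = poch (c - a) n := by
  rw [poch_reflect (c - a) n]
  have : 1 - (c - a) - n = a + (1 - c - n) := by ring
  rw [this, ← poch_vand_range, Finset.mul_sum]
  apply Finset.sum_congr rfl
  intro k hk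
  have hk' : k ≤ n := by simpa [Nat.lt_succ_iff] using hk
  rw [poch_reflect (c + k) (n - k), Nat.cast_sub hk']
  have e : (1 - (c + k) - ((n : ℝ) - k)) = 1 - c - n := by ring
  have e2 : (-1 : ℝ) ^ n = (-1) ^ k * (-1) ^ (n - k) := by
    rw [← pow_add]; congr 1; omega
  rw [e, e2]
  ring

theorem poch_neg_nat (n k : ℕ) (h : k ≤ n) :
    poch (-(n : ℝ)) k * ((n - k).factorial : ℝ) = (-1) ^ k * n.factorial := by
  induction k with
  | zero => simp [poch_zero]
  | succ k ih =>
    have ih := ih (by omega)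
    have e : n - k = (n - (k + 1)) + 1 := by omega
    rw [e, Nat.factorial_succ] at ih
    have e2 : ((n - (k + 1) : ℕ) : ℝ) = n - (k + 1) := by rw [Nat.cast_sub h]; push_cast; ring
    push_cast at ih
    rw [e2] at ih
    rw [poch_succ, pow_succ]
    linear_combination (-1) * ih

theorem poch_neg_nat_zero (n k : ℕ) (h : n < k) : poch (-(n : ℝ)) k = 0 := by
  unfold poch
  apply Finset.prod_eq_zero (Finset.mem_range.mpr h)
  ring

theorem poch_neg_nat_ne (n k : ℕ) (h : k ≤ n) : poch (-(n : ℝ)) k ≠ 0 := by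
  intro h0
  have := poch_neg_nat n k h
  rw [h0, zero_mul] at this
  have h2 : (n.factorial : ℝ) ≠ 0 := by positivity
  have h3 : ((-1 : ℝ)) ^ k ≠ 0 := by simp
  exact (mul_ne_zero h3 h2) this.symm

theorem poch_ne_of_le (a : ℝ) (m n : ℕ) (h : m ≤ n) (hn : poch a n ≠ 0) : poch a m ≠ 0 := by
  obtain ⟨t, rfl⟩ := Nat.exists_eq_add_of_le h
  rw [poch_add] at hn
  exact left_ne_zero_of_mul hn

/-- One-variable weight. -/
def w1 (M : ℕ) (α β : ℝ) (x : ℕ) : ℝ :=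
  poch α x / (x.factorial : ℝ) * (poch β (M - x) / ((M - x).factorial : ℝ))

theorem lemA (M : ℕ) (α β : ℝ) (k j : ℕ) (hk : k ≤ M) :
    ∑ x ∈ Finset.range (M + 1), w1 M α β x * (poch (-(x : ℝ)) k * poch (β + M - x) j)
      = (-1) ^ k * poch α k * poch β j * poch (α + β + k + j) (M - k) / ((M - k).factorial : ℝ) := by
  obtain ⟨m, rfl⟩ := Nat.exists_eq_add_of_le hk
  have e : k + m + 1 = k + (m + 1) := by ring
  rw [e, Finset.sum_range_add]
  have h0 : ∑ x ∈ Finset.range k,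
      w1 (k + m) α β x * (poch (-(x : ℝ)) k * poch (β + (k + m : ℕ) - x) j) = 0 := by
    apply Finset.sum_eq_zero
    intro x hx
    rw [poch_neg_nat_zero x k (by simpa using hx)]
    ring
  rw [h0, zero_add]
  have e3 : k + m - k = m := by omega
  have e4 : α + β + k + j = (α + k) + (β + j) := by ring
  rw [e3, mul_div_assoc, e4, ← poch_vand_div, Finset.mul_sum]
  apply Finset.sum_congr rfl
  intro y hy
  have hy : y ≤ m := by simpa [Nat.lt_succ_iff] using hy
  unfold w1
  have e5 : k + m - (k + y) = m - y := by omega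
  have e6 : β + ((k + m : ℕ) : ℝ) - ((k + y : ℕ) : ℝ) = β + ((m - y : ℕ) : ℝ) := by
    rw [Nat.cast_sub hy]; push_cast; ring
  have e7 : poch β (m - y) * poch (β + ((m - y : ℕ) : ℝ)) j = poch β j * poch (β + j) (m - y) := by
    rw [← poch_add, ← poch_add, add_comm]
  have e8 := poch_neg_nat (k + y) k (by omega)
  have e9 : k + y - k = y := by omega
  rw [e9] at e8
  have h1 : ((k + y).factorial : ℝ) ≠ 0 := by positivity
  have h2 : (y.factorial : ℝ) ≠ 0 := by positivity
  have h3 : ((m - y).factorial : ℝ) ≠ 0 := by positivity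
  have e10 : poch (-((k + y : ℕ) : ℝ)) k = (-1) ^ k * (k + y).factorial / y.factorial := by
    rw [eq_div_iff h2]; exact e8
  rw [e5, e6, e10, poch_add α k y]
  field_simp
  linear_combination (poch α k * poch (α + k) y) * e7

/-- One-variable normalized Hahn polynomial. -/
def q1 (n : ℕ) (α β M x : ℝ) : ℝ :=
  poch α n / poch β n * poch (-M) n * hahn1 n x (α - 1) (β - 1) M

def qc (n : ℕ) (α β M : ℝ) (k : ℕ) : ℝ :=
  poch α n / poch β n * poch (-M) n *
    (poch (-(n : ℝ)) k * poch ((n : ℝ) + α + β - 1) k / (poch α k * poch (-M) k * (k.factorial : ℝ)))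

theorem q1_eq (n : ℕ) (α β M x : ℝ) :
    q1 n α β M x = ∑ k ∈ Finset.range (n + 1), qc n α β M k * poch (-x) k := by
  unfold q1 hahn1 qc
  rw [Finset.mul_sum]
  apply Finset.sum_congr rfl
  intro k _
  have e1 : α - 1 + 1 = α := by ring
  have e2 : (n : ℝ) + (α - 1) + (β - 1) + 1 = n + α + β - 1 := by ring
  rw [e1, e2]
  ring

theorem lemB (M : ℕ) (α β : ℝ) (n j : ℕ) (hn : n ≤ M) (hα : poch α n ≠ 0) :
    ∑ x ∈ Finset.range (M + 1), w1 M α β x * (q1 n α β M x * poch (β + M - x) j)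
      = (-1) ^ n * poch α n / poch β n * poch β j * poch (α + β + j + n) (M - n)
          * poch ((j : ℝ) - n + 1) n / ((M - n).factorial : ℝ) := by
  have s1 : ∀ x : ℕ, w1 M α β x * (q1 n α β M x * poch (β + M - x) j)
      = ∑ k ∈ Finset.range (n + 1), qc n α β M k *
        (w1 M α β x * (poch (-(x : ℝ)) k * poch (β + M - x) j)) := by
    intro x
    rw [q1_eq, Finset.sum_mul, Finset.mul_sum]
    apply Finset.sum_congr rfl
    intro k _
    ring
  simp_rw [s1]
  rw [Finset.sum_comm]
  simp_rw [← Finset.mul_sum]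
  have e0 : (j : ℝ) - n + 1 = (α + β + j) - (n + α + β - 1) := by ring
  have hM : (M.factorial : ℝ) ≠ 0 := by positivity
  have hMn : ((M - n).factorial : ℝ) ≠ 0 := by positivity
  have hpm := poch_neg_nat M n hn
  have hpm' : poch (-(M : ℝ)) n = (-1) ^ n * M.factorial / (M - n).factorial := by
    rw [eq_div_iff hMn]; exact hpm
  rw [e0, ← poch_cv, Finset.mul_sum, Finset.sum_div]
  apply Finset.sum_congr rfl
  intro k hk
  have hk : k ≤ n := by simpa [Nat.lt_succ_iff] using hk
  rw [lemA M α β k j (by omega)]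
  unfold qc
  have hαk := poch_ne_of_le α k n hk hα
  have hMk := poch_neg_nat_ne M k (by omega)
  have hmk := poch_neg_nat M k (by omega)
  have hnk := poch_neg_nat n k hk
  have hch : (n.factorial : ℝ) = n.choose k * k.factorial * (n - k).factorial := by
    exact_mod_cast (Nat.choose_mul_factorial_mul_factorial hk).symm
  have f1 : (k.factorial : ℝ) ≠ 0 := by positivity
  have f2 : ((n - k).factorial : ℝ) ≠ 0 := by positivity
  have f3 : ((M - k).factorial : ℝ) ≠ 0 := by positivity
  have hnk' : poch (-(n : ℝ)) k = (-1) ^ k * n.choose k * k.factorial := by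
    apply mul_right_cancel₀ f2
    rw [hnk, hch]; ring
  have hmk' : poch (-(M : ℝ)) k = (-1) ^ k * M.factorial / (M - k).factorial := by
    rw [eq_div_iff f3]; exact hmk
  have hsp : poch (α + β + k + j) (M - k)
      = poch (α + β + j + k) (n - k) * poch (α + β + j + n) (M - n) := by
    have e : M - k = (n - k) + (M - n) := by omega
    rw [e, poch_add, Nat.cast_sub hk]
    congr 2 <;> ring
  rw [hsp, hnk', hmk', hpm']
  have sq : ((-1 : ℝ) ^ k) ≠ 0 := by simp
  have sq2 : ((-1 : ℝ) ^ k) * (-1) ^ k = 1 := by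
    rw [← mul_pow]; simp
  by_cases hβ : poch β n = 0
  · simp [hβ]
  field_simp

theorem poch_one (n : ℕ) : poch 1 n = n.factorial := by
  induction n with
  | zero => simp [poch_zero]
  | succ n ih => rw [poch_succ, ih, Nat.factorial_succ]; push_cast; ring

theorem poch_vanish (j n : ℕ) (h : j < n) : poch ((j : ℝ) - n + 1) n = 0 := by
  have e : (j : ℝ) - n + 1 = -((n - 1 - j : ℕ) : ℝ) := by
    rw [Nat.cast_sub (by omega), Nat.cast_sub (by omega)]; push_cast; ring
  rw [e]
  exact poch_neg_nat_zero _ _ (by omega)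

theorem lemC (M : ℕ) (α β : ℝ) (n k : ℕ) (hn : n ≤ M) (hα : poch α n ≠ 0) (hβ : poch β n ≠ 0)
    (hk : k ≤ n) :
    ∑ x ∈ Finset.range (M + 1), w1 M α β x * (q1 n α β M x * poch (-(x : ℝ)) k)
      = if k = n then (-1) ^ n * poch α n * poch (α + β + 2 * n) (M - n)
          * n.factorial / ((M - n).factorial : ℝ) else 0 := by
  have s1 : ∀ x : ℕ, w1 M α β x * (q1 n α β M x * poch (-(x : ℝ)) k)
      = ∑ j ∈ Finset.range (k + 1), (k.choose j * poch (-β - M) (k - j)) *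
        (w1 M α β x * (q1 n α β M x * poch (β + M - x) j)) := by
    intro x
    have e : -(x : ℝ) = (β + M - x) + (-β - M) := by ring
    rw [e, ← poch_vand_range, Finset.mul_sum, Finset.mul_sum]
    apply Finset.sum_congr rfl
    intro k _
    ring
  simp_rw [s1]
  rw [Finset.sum_comm]
  simp_rw [← Finset.mul_sum, lemB M α β n _ hn hα]
  rw [Finset.sum_range_succ, Finset.sum_eq_zero]
  · split_ifs with h
    · subst h
      have e : (k : ℝ) - k + 1 = 1 := by ring
      have e2 : α + β + k + k = α + β + 2 * k := by ring
      rw [e, poch_one, e2]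
      simp [poch_zero]
      field_simp
    · rw [poch_vanish k n (by omega)]
      ring
  · intro j hj
    have hj : j < k := by simpa using hj
    rw [poch_vanish j n (by omega)]
    ring

theorem lemD (M : ℕ) (α β : ℝ) (n k : ℕ) (hn : n ≤ M) (hα : poch α n ≠ 0) (hβ : poch β n ≠ 0)
    (hk : k ≤ n) :
    ∑ x ∈ Finset.range (M + 1), w1 M α β x * (q1 n α β M x * q1 k α β M x)
      = if k = n then poch (n + α + β - 1) n / poch β n * poch α n * n.factorial
          * (poch (α + β + 2 * n) (M - n) / ((M - n).factorial : ℝ)) else 0 := by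
  have s1 : ∀ x : ℕ, w1 M α β x * (q1 n α β M x * q1 k α β M x)
      = ∑ j ∈ Finset.range (k + 1), qc k α β M j *
        (w1 M α β x * (q1 n α β M x * poch (-(x : ℝ)) j)) := by
    intro x
    rw [q1_eq k, Finset.mul_sum, Finset.mul_sum]
    apply Finset.sum_congr rfl
    intro k _
    ring
  simp_rw [s1]
  rw [Finset.sum_comm]
  simp_rw [← Finset.mul_sum]
  rw [Finset.sum_range_succ, Finset.sum_eq_zero, lemC M α β n k hn hα hβ hk]
  · split_ifs with h
    · subst h
      have hMk := poch_neg_nat_ne M k hn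
      have h1 := poch_neg_nat k k le_rfl
      simp at h1
      unfold qc
      rw [h1]
      have f1 : (k.factorial : ℝ) ≠ 0 := by positivity
      have sq2 : ((-1 : ℝ) ^ k) * (-1) ^ k = 1 := by
        rw [← mul_pow]; simp
      field_simp
      linear_combination (poch α k * k.factorial * poch (k + α + β - 1) k * poch (α + β + k * 2) (M - k)) * sq2
    · ring
  · intro j hj
    have hj : j < k := by simpa using hj
    rw [lemC M α β n j hn hα hβ (by omega), if_neg (by omega)]
    ring

theorem q1_zero (n M : ℕ) (α β x : ℝ) (h : M < n) : q1 n α β M x = 0 := by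
  unfold q1
  rw [poch_neg_nat_zero M n h]
  ring

theorem hahn_one (M : ℕ) (α β : ℝ) (n k : ℕ) (hα : poch α n ≠ 0) (hβ : poch β n ≠ 0)
    (hα' : poch α k ≠ 0) (hβ' : poch β k ≠ 0) :
    ∑ x ∈ Finset.range (M + 1), w1 M α β x * (q1 n α β M x * q1 k α β M x)
      = if k = n then (if n ≤ M then poch (n + α + β - 1) n / poch β n * poch α n * n.factorial
          * (poch (α + β + 2 * n) (M - n) / ((M - n).factorial : ℝ)) else 0) else 0 := by
  by_cases hn : n ≤ M
  · by_cases hk : k ≤ M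
    · rcases le_total k n with h | h
      · rw [lemD M α β n k hn hα hβ h]
        simp [hn]
      · have := lemD M α β k n hk hα' hβ' h
        simp_rw [mul_comm (q1 n _ _ _ _)]
        rw [this]
        by_cases e : k = n
        · subst e; simp [hn]
        · rw [if_neg e, if_neg (fun h => e h.symm)]
    · rw [if_neg (by omega)]
      apply Finset.sum_eq_zero
      intro x _
      rw [q1_zero k M _ _ _ (by omega)]; ring
  · simp only [hn, if_false, ite_self]
    apply Finset.sum_eq_zero
    intro x _
    rw [q1_zero n M _ _ _ (by omega)]; ring

theorem tailSum_zero (d : ℕ) (ν : Fin (d + 1) → ℕ) :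
    tailSum (d + 1) ν 0 = ∑ i, Fin.tail ν i := by
  unfold tailSum Fin.tail
  rw [Finset.sum_filter, Fin.sum_univ_succ]
  simp

theorem tailSum_succ (d : ℕ) (ν : Fin (d + 1) → ℕ) (j : Fin d) :
    tailSum (d + 1) ν j.succ = tailSum d (Fin.tail ν) j := by
  unfold tailSum Fin.tail
  rw [Finset.sum_filter, Fin.sum_univ_succ, Finset.sum_filter]
  simp

theorem tailSumL_zero (d : ℕ) (ℓ : Fin (d + 2) → ℕ) :
    tailSumL (d + 1) ℓ 0 = ∑ i, Fin.tail ℓ i := by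
  unfold tailSumL Fin.tail
  rw [Finset.sum_filter, Fin.sum_univ_succ]
  simp

theorem tailSumL_succ (d : ℕ) (ℓ : Fin (d + 2) → ℕ) (j : Fin d) :
    tailSumL (d + 1) ℓ j.succ = tailSumL d (Fin.tail ℓ) j := by
  unfold tailSumL Fin.tail
  rw [Finset.sum_filter, Fin.sum_univ_succ, Finset.sum_filter]
  simp

theorem aCoef_zero (d : ℕ) (ℓ : Fin (d + 2) → ℕ) (ν : Fin (d + 1) → ℕ) :
    aCoef (d + 1) ℓ ν 0
      = -((∑ i, Fin.tail ℓ i : ℕ) : ℝ) + 2 * ((∑ i, Fin.tail ν i : ℕ) : ℝ) - 1 := by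
  unfold aCoef
  rw [tailSum_zero, tailSumL_zero]

theorem aCoef_succ (d : ℕ) (ℓ : Fin (d + 2) → ℕ) (ν : Fin (d + 1) → ℕ) (j : Fin d) :
    aCoef (d + 1) ℓ ν j.succ = aCoef d (Fin.tail ℓ) (Fin.tail ν) j := by
  unfold aCoef
  rw [tailSum_succ, tailSumL_succ]

theorem headSum_cons_zero (d : ℕ) (x : Fin (d + 1) → ℝ) :
    headSum (d + 1) x 0 = 0 := by
  unfold headSum
  simp

theorem headSum_cons_succ (d : ℕ) (i : ℕ) (y : Fin d → ℕ) (j : Fin d) :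
    headSum (d + 1) (fun k => ((Fin.cons i y : Fin (d + 1) → ℕ) k : ℝ)) j.succ
      = i + headSum d (fun k => (y k : ℝ)) j := by
  unfold headSum
  rw [Finset.sum_filter, Fin.sum_univ_succ, Finset.sum_filter]
  simp

/-- Unnormalized polynomial. -/
def PP (d : ℕ) (N : ℝ) (ℓ : Fin (d + 1) → ℕ) (ν : Fin d → ℕ) (x : Fin d → ℕ) : ℝ :=
  ∏ j : Fin d,
    poch (-(ℓ j.castSucc : ℝ)) (ν j) / poch (aCoef d ℓ ν j + 1) (ν j) *
      poch (-N + headSum d (fun i => (x i : ℝ)) j + (tailSum d ν j : ℝ)) (ν j) *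
      hahn1 (ν j) (x j) (-(ℓ j.castSucc : ℝ) - 1) (aCoef d ℓ ν j)
        (N - headSum d (fun i => (x i : ℝ)) j - (tailSum d ν j : ℝ))

theorem PP_cons (d : ℕ) (N : ℝ) (ℓ : Fin (d + 2) → ℕ) (ν : Fin (d + 1) → ℕ) (i : ℕ)
    (y : Fin d → ℕ) :
    PP (d + 1) N ℓ ν (Fin.cons i y) =
      q1 (ν 0) (-(ℓ 0 : ℝ))
        (-((∑ i, Fin.tail ℓ i : ℕ) : ℝ) + 2 * ((∑ i, Fin.tail ν i : ℕ) : ℝ))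
        (N - ((∑ i, Fin.tail ν i : ℕ) : ℝ)) i
      * PP d (N - i) (Fin.tail ℓ) (Fin.tail ν) y := by
  unfold PP
  rw [Fin.prod_univ_succ]
  congr 1
  · rw [aCoef_zero, headSum_cons_zero, tailSum_zero]
    unfold q1
    simp only [Fin.castSucc_zero, Fin.cons_zero]
    congr 2
    · congr 2
      ring
    · congr 1
      ring
    · ring
  · apply Finset.prod_congr rfl
    intro j _
    rw [aCoef_succ, headSum_cons_succ, tailSum_succ]
    simp only [Fin.cons_succ]
    have e1 : ℓ j.succ.castSucc = Fin.tail ℓ j.castSucc := rfl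
    have e2 : ν j.succ = Fin.tail ν j := rfl
    have e3 : ∀ h t : ℝ, -N + (i + h) + t = -(N - i) + h + t := by intros; ring
    have e4 : ∀ h t : ℝ, N - (i + h) - t = (N - i) - h - t := by intros; ring
    rw [e1, e2, e3, e4]

/-- Unnormalized weight. -/
def WW (d N : ℕ) (ℓ : Fin (d + 1) → ℕ) (x : Fin d → ℕ) : ℝ :=
  (∏ i : Fin d, poch (-(ℓ i.castSucc : ℝ)) (x i) / (Nat.factorial (x i) : ℝ)) *
      (poch (-(ℓ (Fin.last d) : ℝ)) (N - ∑ i, x i) /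
        (Nat.factorial (N - ∑ i, x i) : ℝ))

theorem WW_cons (d N : ℕ) (ℓ : Fin (d + 2) → ℕ) (i : ℕ) (y : Fin d → ℕ) :
    WW (d + 1) N ℓ (Fin.cons i y) =
      poch (-(ℓ 0 : ℝ)) i / (Nat.factorial i : ℝ) * WW d (N - i) (Fin.tail ℓ) y := by
  unfold WW
  rw [Fin.prod_univ_succ, Fin.sum_univ_succ]
  simp only [Fin.cons_zero, Fin.cons_succ, Fin.castSucc_zero, Nat.sub_sub]
  rw [mul_assoc]
  rfl

/-- Discrete simplex. -/
def SS (d N : ℕ) : Finset (Fin d → ℕ) :=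
  (Fintype.piFinset fun _ : Fin d => Finset.range (N + 1)).filter fun x => ∑ i, x i ≤ N

theorem mem_SS (d N : ℕ) (x : Fin d → ℕ) : x ∈ SS d N ↔ ∑ i, x i ≤ N := by
  unfold SS
  simp only [Finset.mem_filter, Fintype.mem_piFinset, Finset.mem_range, and_iff_right_iff_imp]
  intro h i
  have := Finset.single_le_sum (f := x) (fun j _ => Nat.zero_le _) (Finset.mem_univ i)
  omega

theorem sum_SS (d N : ℕ) (f : (Fin (d + 1) → ℕ) → ℝ) :
    ∑ x ∈ SS (d + 1) N, f x = ∑ i ∈ Finset.range (N + 1), ∑ y ∈ SS d (N - i), f (Fin.cons i y) := by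
  rw [Finset.sum_sigma']
  apply Finset.sum_bij' (fun x _ => (⟨x 0, Fin.tail x⟩ : (_ : ℕ) × (Fin d → ℕ)))
    (fun p _ => (Fin.cons p.1 p.2 : Fin (d + 1) → ℕ))
  · intro x hx
    rw [mem_SS, Fin.sum_univ_succ] at hx
    rw [Finset.mem_sigma, mem_SS, Finset.mem_range]
    unfold Fin.tail
    dsimp only
    omega
  · intro p hp
    rw [Finset.mem_sigma, mem_SS, Finset.mem_range] at hp
    rw [mem_SS, Fin.sum_univ_succ]
    simp only [Fin.cons_zero, Fin.cons_succ]
    omega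
  · intro x _
    simp
  · intro p _
    simp
  · intro x _
    simp

/-- Factor of the norm. -/
def gg (d : ℕ) (ℓ : Fin (d + 1) → ℕ) (ν : Fin d → ℕ) (j : Fin d) : ℝ :=
  poch (-(ℓ j.castSucc : ℝ) + aCoef d ℓ ν j) (2 * ν j) *
          poch (-(ℓ j.castSucc : ℝ)) (ν j) * (Nat.factorial (ν j) : ℝ) /
        (poch (-(ℓ j.castSucc : ℝ) + aCoef d ℓ ν j) (ν j) *
          poch (aCoef d ℓ ν j + 1) (ν j))

def GG (d N : ℕ) (ℓ : Fin (d + 1) → ℕ) (ν : Fin d → ℕ) : ℝ :=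
  if (∑ i, ν i) ≤ N then
    poch (-((∑ i, ℓ i : ℕ) : ℝ) + 2 * ((∑ i, ν i : ℕ) : ℝ)) (N - ∑ i, ν i)
      / (Nat.factorial (N - ∑ i, ν i) : ℝ) * ∏ j : Fin d, gg d ℓ ν j
  else 0

theorem gg_succ (d : ℕ) (ℓ : Fin (d + 2) → ℕ) (ν : Fin (d + 1) → ℕ) (j : Fin d) :
    gg (d + 1) ℓ ν j.succ = gg d (Fin.tail ℓ) (Fin.tail ν) j := by
  unfold gg
  rw [aCoef_succ]
  rfl

theorem gg_zero (d : ℕ) (ℓ : Fin (d + 2) → ℕ) (ν : Fin (d + 1) → ℕ) (α β : ℝ)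
    (hα : α = -(ℓ 0 : ℝ))
    (hβ : β = -((∑ i, Fin.tail ℓ i : ℕ) : ℝ) + 2 * ((∑ i, Fin.tail ν i : ℕ) : ℝ))
    (h : poch (α + β - 1) (ν 0) ≠ 0) :
    gg (d + 1) ℓ ν 0 = poch (ν 0 + α + β - 1) (ν 0) / poch β (ν 0) * poch α (ν 0)
      * (ν 0).factorial := by
  unfold gg
  rw [aCoef_zero, ← hβ, Fin.castSucc_zero, ← hα]
  have e1 : α + (β - 1) = α + β - 1 := by ring
  have e2 : β - 1 + 1 = β := by ring
  have e3 : α + β - 1 + (ν 0 : ℝ) = ν 0 + α + β - 1 := by ring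
  rw [e1, e2, two_mul, poch_add, e3]
  by_cases hb : poch β (ν 0) = 0
  · simp [hb]
  · field_simp

def okIdx (d : ℕ) (ℓ : Fin (d + 1) → ℕ) (ν : Fin d → ℕ) : Prop :=
  ∀ j : Fin d, ν j ≤ ℓ j.castSucc ∧ ν j + 2 * tailSum d ν j ≤ tailSumL d ℓ j

theorem okIdx_tail (d : ℕ) (ℓ : Fin (d + 2) → ℕ) (ν : Fin (d + 1) → ℕ)
    (h : okIdx (d + 1) ℓ ν) : okIdx d (Fin.tail ℓ) (Fin.tail ν) := by
  intro j
  have := h j.succ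
  rw [tailSum_succ, tailSumL_succ] at this
  exact this

theorem okIdx_zero (d : ℕ) (ℓ : Fin (d + 2) → ℕ) (ν : Fin (d + 1) → ℕ)
    (h : okIdx (d + 1) ℓ ν) :
    ν 0 ≤ ℓ 0 ∧ ν 0 + 2 * (∑ i, Fin.tail ν i) ≤ ∑ i, Fin.tail ℓ i := by
  have := h 0
  rw [tailSum_zero, tailSumL_zero] at this
  exact this

theorem main_step (d : ℕ)
    (ih : ∀ (N : ℕ) (ℓ : Fin (d + 1) → ℕ) (ν μ : Fin d → ℕ), okIdx d ℓ ν → okIdx d ℓ μ →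
      ∑ x ∈ SS d N, PP d N ℓ ν x * PP d N ℓ μ x * WW d N ℓ x = if ν = μ then GG d N ℓ ν else 0)
    (N : ℕ) (ℓ : Fin (d + 2) → ℕ) (ν μ : Fin (d + 1) → ℕ)
    (hν : okIdx (d + 1) ℓ ν) (hμ : okIdx (d + 1) ℓ μ) :
    ∑ x ∈ SS (d + 1) N, PP (d + 1) N ℓ ν x * PP (d + 1) N ℓ μ x * WW (d + 1) N ℓ x
      = if ν = μ then GG (d + 1) N ℓ ν else 0 := by
  have hνμ : ν = μ ↔ (ν 0 = μ 0 ∧ Fin.tail ν = Fin.tail μ) := by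
    constructor
    · rintro rfl; simp
    · rintro ⟨h1, h2⟩
      rw [← Fin.cons_self_tail ν, ← Fin.cons_self_tail μ, h1, h2]
  have key : ∀ i ∈ Finset.range (N + 1),
      ∑ y ∈ SS d (N - i), PP (d + 1) N ℓ ν (Fin.cons i y) * PP (d + 1) N ℓ μ (Fin.cons i y)
        * WW (d + 1) N ℓ (Fin.cons i y)
      = poch (-(ℓ 0 : ℝ)) i / (Nat.factorial i : ℝ) *
      (q1 (ν 0) (-(ℓ 0 : ℝ))
        (-((∑ i, Fin.tail ℓ i : ℕ) : ℝ) + 2 * ((∑ i, Fin.tail ν i : ℕ) : ℝ))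
        (N - ((∑ i, Fin.tail ν i : ℕ) : ℝ)) i *
      q1 (μ 0) (-(ℓ 0 : ℝ))
        (-((∑ i, Fin.tail ℓ i : ℕ) : ℝ) + 2 * ((∑ i, Fin.tail μ i : ℕ) : ℝ))
        (N - ((∑ i, Fin.tail μ i : ℕ) : ℝ)) i) *
      (if Fin.tail ν = Fin.tail μ then GG d (N - i) (Fin.tail ℓ) (Fin.tail ν) else 0) := by
    intro i hi
    have hi : i ≤ N := by simpa [Nat.lt_succ_iff] using hi
    rw [← ih (N - i) (Fin.tail ℓ) _ _ (okIdx_tail d ℓ ν hν) (okIdx_tail d ℓ μ hμ), Finset.mul_sum]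
    apply Finset.sum_congr rfl
    intro y _
    rw [PP_cons, PP_cons, WW_cons, Nat.cast_sub hi]
    ring
  rw [sum_SS, Finset.sum_congr rfl key]
  by_cases ht : Fin.tail ν = Fin.tail μ
  swap
  · rw [if_neg (fun h => ht (hνμ.mp h).2)]
    simp [ht]
  simp only [ht, if_true]
  rw [← ht]
  have hν0 := okIdx_zero d ℓ ν hν
  have hμ0 := okIdx_zero d ℓ μ hμ
  rw [← ht] at hμ0
  have hsν : ∑ i, ν i = ν 0 + ∑ i, Fin.tail ν i := Fin.sum_univ_succ ν
  have hsℓ : ∑ i, ℓ i = ℓ 0 + ∑ i, Fin.tail ℓ i := Fin.sum_univ_succ ℓ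
  have hG : ∀ K, GG d K (Fin.tail ℓ) (Fin.tail ν) = if (∑ i, Fin.tail ν i) ≤ K then
    poch (-((∑ i, Fin.tail ℓ i : ℕ) : ℝ) + 2 * ((∑ i, Fin.tail ν i : ℕ) : ℝ))
      (K - ∑ i, Fin.tail ν i)
      / (Nat.factorial (K - ∑ i, Fin.tail ν i) : ℝ) * ∏ j : Fin d, gg d (Fin.tail ℓ) (Fin.tail ν) j
    else 0 := fun K => rfl
  have hG' : GG (d + 1) N ℓ ν = if (∑ i, ν i) ≤ N then
    poch (-((∑ i, ℓ i : ℕ) : ℝ) + 2 * ((∑ i, ν i : ℕ) : ℝ)) (N - ∑ i, ν i)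
      / (Nat.factorial (N - ∑ i, ν i) : ℝ) * ∏ j : Fin (d + 1), gg (d + 1) ℓ ν j
    else 0 := rfl
  rw [hG', Fin.prod_univ_succ]
  simp_rw [gg_succ, hG]
  generalize (∏ j : Fin d, gg d (Fin.tail ℓ) (Fin.tail ν) j) = C
  have hgz := gg_zero d ℓ ν _ _ rfl rfl
  rw [hsν, hsℓ]
  generalize hm : ∑ i, Fin.tail ν i = m at *
  generalize hL : ∑ i, Fin.tail ℓ i = L at *
  by_cases hmN : m ≤ N
  swap
  · rw [if_neg (c := ν 0 + m ≤ N) (by omega), ite_self]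
    apply Finset.sum_eq_zero
    intro i _
    rw [if_neg (by omega), mul_zero]
  obtain ⟨M, rfl⟩ := Nat.exists_eq_add_of_le hmN
  obtain ⟨b, hb⟩ := Nat.exists_eq_add_of_le (show 2 * m ≤ L by omega)
  have hβ : -(L : ℝ) + 2 * (m : ℝ) = -(b : ℝ) := by rw [hb]; push_cast; ring
  have hMm : ((m + M : ℕ) : ℝ) - m = M := by push_cast; ring
  rw [hβ] at hgz
  simp only [hβ]
  rw [hMm]
  rw [hgz (by
    have : -(ℓ 0 : ℝ) + -(b : ℝ) - 1 = -((ℓ 0 + b + 1 : ℕ) : ℝ) := by push_cast; ring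
    rw [this]
    exact poch_neg_nat_ne _ _ (by omega))]
  have h1 := hahn_one M (-(ℓ 0 : ℝ)) (-(b : ℝ)) (ν 0) (μ 0)
    (poch_neg_nat_ne _ _ (by omega)) (poch_neg_nat_ne _ _ (by omega))
    (poch_neg_nat_ne _ _ (by omega)) (poch_neg_nat_ne _ _ (by omega))
  have e : m + M + 1 = (M + 1) + m := by ring
  rw [e, Finset.sum_range_add]
  have hz : ∀ f : ℕ → ℝ, ∑ x ∈ Finset.range m, f x *
      (if m ≤ m + M - (M + 1 + x) then poch (-(b : ℝ)) (m + M - (M + 1 + x) - m) /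
        ((m + M - (M + 1 + x) - m).factorial : ℝ) * C else 0) = 0 := by
    intro f
    apply Finset.sum_eq_zero
    intro x hx
    have hx : x < m := by simpa using hx
    rw [if_neg (by omega), mul_zero]
  rw [hz, add_zero]
  have hcond : (ν = μ) ↔ (μ 0 = ν 0) := by
    rw [hνμ]; simp [ht, eq_comm]
  simp only [hcond]
  have hs : ∀ i ∈ Finset.range (M + 1),
      poch (-(ℓ 0 : ℝ)) i / (Nat.factorial i : ℝ) *
      (q1 (ν 0) (-(ℓ 0 : ℝ)) (-(b : ℝ)) M i * q1 (μ 0) (-(ℓ 0 : ℝ)) (-(b : ℝ)) M i) *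
      (if m ≤ m + M - i then poch (-(b : ℝ)) (m + M - i - m) /
        ((m + M - i - m).factorial : ℝ) * C else 0)
      = w1 M (-(ℓ 0 : ℝ)) (-(b : ℝ)) i * (q1 (ν 0) (-(ℓ 0 : ℝ)) (-(b : ℝ)) M i *
          q1 (μ 0) (-(ℓ 0 : ℝ)) (-(b : ℝ)) M i) * C := by
    intro i hi
    have hi : i ≤ M := by simpa [Nat.lt_succ_iff] using hi
    have e1 : m + M - i - m = M - i := by omega
    rw [if_pos (by omega), e1]
    unfold w1
    ring
  rw [Finset.sum_congr rfl hs, ← Finset.sum_mul, h1]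
  by_cases hc : μ 0 = ν 0
  · rw [if_pos hc, if_pos hc]
    by_cases hn : ν 0 ≤ M
    · rw [if_pos hn, if_pos (by omega)]
      have e1 : m + M - (ν 0 + m) = M - ν 0 := by omega
      have e2 : -((ℓ 0 + L : ℕ) : ℝ) + 2 * ((ν 0 + m : ℕ) : ℝ)
          = -(ℓ 0 : ℝ) + -(b : ℝ) + 2 * (ν 0 : ℝ) := by
        rw [← hβ]; push_cast; ring
      rw [e1, e2]
      ring
    · rw [if_neg hn, if_neg (by omega), zero_mul]
  · rw [if_neg hc, if_neg hc, zero_mul]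

theorem main_orth (d : ℕ) : ∀ (N : ℕ) (ℓ : Fin (d + 1) → ℕ) (ν μ : Fin d → ℕ),
      okIdx d ℓ ν → okIdx d ℓ μ →
      ∑ x ∈ SS d N, PP d N ℓ ν x * PP d N ℓ μ x * WW d N ℓ x
        = if ν = μ then GG d N ℓ ν else 0 := by
  induction d with
  | zero =>
    intro N ℓ ν μ _ _
    have h : SS 0 N = {default} := by
      ext x
      rw [mem_SS]
      simp [Subsingleton.elim x default]
    rw [h, if_pos (Subsingleton.elim _ _)]
    simp [PP, WW, GG]
  | succ d ih =>
    exact fun N ℓ ν μ hν hμ => main_step d ih N ℓ ν μ hν hμ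

theorem WW_zero (d N : ℕ) (ℓ : Fin (d + 1) → ℕ) (x : Fin d → ℕ) (hx : x ∈ SS d N)
    (h : x ∉ polyDomain d N ℓ) : WW d N ℓ x = 0 := by
  rw [mem_SS] at hx
  unfold WW
  by_cases hb : ∀ i, x i ≤ ℓ i.castSucc
  · have h2 : ¬ (N - ℓ (Fin.last d) ≤ ∑ i, x i) := by
      intro h3
      apply h
      unfold polyDomain
      simp only [Finset.mem_filter, Fintype.mem_piFinset, Finset.mem_range]
      exact ⟨fun i => Nat.lt_succ_of_le (hb i), h3, hx⟩
    rw [poch_neg_nat_zero (ℓ (Fin.last d)) (N - ∑ i, x i) (by omega)]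
    ring
  · push Not at hb
    obtain ⟨i, hi⟩ := hb
    rw [Finset.prod_eq_zero (Finset.mem_univ i)]
    · ring
    · rw [poch_neg_nat_zero _ _ hi]; ring

/-- Orthogonality of the Hahn polynomials on the polyhedron:
`⟨Q_ν, Q_μ⟩_{ℓ,N} = B_ν(ℓ,N) δ_{ν,μ}` for `ν, μ ∈ H_{ℓ,N}^d`. -/
theorem stmt4 (d N : ℕ) (hd : 1 ≤ d) (hN : 1 ≤ N) (ℓ : Fin (d + 1) → ℕ)
    (hpos : ∀ i, 1 ≤ ℓ i) (hle : ∀ i, ℓ i ≤ N)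
    (hpair : ∀ i j : Fin (d + 1), i < j → N ≤ ℓ i + ℓ j)
    (ν μ : Fin d → ℕ) (hν : ν ∈ indexSet d N ℓ) (hμ : μ ∈ indexSet d N ℓ) :
    innerH d N ℓ (fun x => hahnQ d N ℓ ν fun i => (x i : ℝ))
        (fun x => hahnQ d N ℓ μ fun i => (x i : ℝ)) =
      if ν = μ then normB d N ℓ ν else 0 := by
  have hsum : innerH d N ℓ (fun x => hahnQ d N ℓ ν fun i => (x i : ℝ))
        (fun x => hahnQ d N ℓ μ fun i => (x i : ℝ))
      = ((-1 : ℝ) ^ (∑ i, ν i) / poch (-(N : ℝ)) (∑ i, ν i)) *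
        ((-1 : ℝ) ^ (∑ i, μ i) / poch (-(N : ℝ)) (∑ i, μ i)) *
        ((Nat.factorial N : ℝ) / poch (-((∑ i, ℓ i : ℕ) : ℝ)) N) *
        ∑ x ∈ SS d N, PP d N ℓ ν x * PP d N ℓ μ x * WW d N ℓ x := by
    have hsub : polyDomain d N ℓ ⊆ SS d N := by
      intro x hx
      rw [mem_SS]
      unfold polyDomain at hx
      exact (Finset.mem_filter.mp hx).2.2
    rw [← Finset.sum_subset hsub (fun x hx hx' => by rw [WW_zero d N ℓ x hx hx']; ring)]
    unfold innerH
    rw [Finset.mul_sum]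
    apply Finset.sum_congr rfl
    intro x _
    unfold hahnQ weightH PP WW
    ring
  obtain ⟨h1, h2, h3⟩ := hν
  obtain ⟨_, _, h3'⟩ := hμ
  rw [hsum, main_orth d N ℓ ν μ h3 h3']
  by_cases hc : ν = μ
  swap
  · rw [if_neg hc, if_neg hc, mul_zero]
  rw [if_pos hc, if_pos hc, ← hc]
  unfold GG normB
  rw [if_pos h1]
  have hgg : ∀ C : ℝ, C * ∏ j, gg d ℓ ν j = C * ∏ j : Fin d,
      poch (-(ℓ j.castSucc : ℝ) + aCoef d ℓ ν j) (2 * ν j) *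
          poch (-(ℓ j.castSucc : ℝ)) (ν j) * (Nat.factorial (ν j) : ℝ) /
        (poch (-(ℓ j.castSucc : ℝ) + aCoef d ℓ ν j) (ν j) *
          poch (aCoef d ℓ ν j + 1) (ν j)) := fun C => rfl
  rw [← hgg, ← mul_assoc]
  congr 1
  generalize hn : ∑ i, ν i = n at *
  generalize hL : ∑ i, ℓ i = L at *
  have hsplit : poch (-(L : ℝ)) (N + n)
      = poch (-(L : ℝ)) (2 * n) * poch (-(L : ℝ) + 2 * (n : ℝ)) (N - n) := by
    have e : N + n = 2 * n + (N - n) := by omega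
    rw [e, poch_add]
    push_cast
    rfl
  have a1 := poch_neg_nat_ne L (2 * n) (by omega)
  have a2 := poch_neg_nat_ne L N (by omega)
  have a3 := poch_neg_nat_ne N n h1
  have a4 := poch_neg_nat N n h1
  have f1 : ((N - n).factorial : ℝ) ≠ 0 := by positivity
  have f2 : (N.factorial : ℝ) ≠ 0 := by positivity
  have a5 : poch (-(N : ℝ)) n = (-1) ^ n * N.factorial / (N - n).factorial := by
    rw [eq_div_iff f1]; exact a4
  have sq : ((-1 : ℝ) ^ n) ≠ 0 := by simp
  have sq2 : ((-1 : ℝ) ^ n) * (-1) ^ n = 1 := by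
    rw [← mul_pow]; simp
  rw [hsplit, a5]
  field_simp

end
end

section
/- Let d ≥ 2 be an integer and ℓ_1, …, ℓ_{d+1} ∈ ℝ with ℓ_k(ℓ_k+2) ≠ 0 for every k (in particular this holds when all ℓ_k are positive integers). Then, inside the algebra of ℝ-linear endomorphisms of the space of functions ℤ^{d+1} → ℝ, the unital ℝ-subalgebra generated by all the operators {L_{i,j} : 1 ≤ i < j ≤ d+1} equals the unital ℝ-subalgebra generated by the set S = {L_{1,j} : j = 2,…,d} ∪ {L_{i,d+1} : i = 1,…,d} of 2d−1 operators. -/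
open Finset

/-- The operator `L_{i,j}` for distinct `i, j ∈ {1,…,d+1}`, as a linear endomorphism
of the space of functions `ℤ^{d+1} → ℝ`. -/
def LopE (n : ℕ) (ℓ : Fin n → ℝ) (i j : Fin n) :
    Module.End ℝ ((Fin n → ℤ) → ℝ) where
  toFun f := fun x =>
    (x j : ℝ) * ((x i : ℝ) - ℓ i) * (f (x + Pi.single i 1 - Pi.single j 1) - f x) +
      (x i : ℝ) * ((x j : ℝ) - ℓ j) * (f (x + Pi.single j 1 - Pi.single i 1) - f x)
  map_add' f g := by funext x; simp only [Pi.add_apply]; ring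
  map_smul' c f := by
    funext x; simp only [Pi.smul_apply, smul_eq_mul, RingHom.id_apply]; ring

abbrev Fun4 := ℤ → ℤ → ℤ → ℤ → ℝ

noncomputable def M12 (p q : ℝ) (g : Fun4) : Fun4 := fun a b c e =>
  (b : ℝ) * (a - p) * g (a+1) (b-1) c e + (a : ℝ) * (b - q) * g (a-1) (b+1) c e
    - ((b : ℝ) * (a - p) + a * (b - q) + p * q / 2) * g a b c e
noncomputable def M13 (p q : ℝ) (g : Fun4) : Fun4 := fun a b c e =>
  (c : ℝ) * (a - p) * g (a+1) b (c-1) e + (a : ℝ) * (c - q) * g (a-1) b (c+1) e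
    - ((c : ℝ) * (a - p) + a * (c - q) + p * q / 2) * g a b c e
noncomputable def M14 (p q : ℝ) (g : Fun4) : Fun4 := fun a b c e =>
  (e : ℝ) * (a - p) * g (a+1) b c (e-1) + (a : ℝ) * (e - q) * g (a-1) b c (e+1)
    - ((e : ℝ) * (a - p) + a * (e - q) + p * q / 2) * g a b c e
noncomputable def M23 (p q : ℝ) (g : Fun4) : Fun4 := fun a b c e =>
  (c : ℝ) * (b - p) * g a (b+1) (c-1) e + (b : ℝ) * (c - q) * g a (b-1) (c+1) e
    - ((c : ℝ) * (b - p) + b * (c - q) + p * q / 2) * g a b c e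
noncomputable def M24 (p q : ℝ) (g : Fun4) : Fun4 := fun a b c e =>
  (e : ℝ) * (b - p) * g a (b+1) c (e-1) + (b : ℝ) * (e - q) * g a (b-1) c (e+1)
    - ((e : ℝ) * (b - p) + b * (e - q) + p * q / 2) * g a b c e
noncomputable def M34 (p q : ℝ) (g : Fun4) : Fun4 := fun a b c e =>
  (e : ℝ) * (c - p) * g a b (c+1) (e-1) + (c : ℝ) * (e - q) * g a b (c-1) (e+1)
    - ((e : ℝ) * (c - p) + c * (e - q) + p * q / 2) * g a b c e

noncomputable def T124 (p q s : ℝ) (g : Fun4) : Fun4 := fun a b c e =>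
  -2 * (a - p) * (b - q / 2) * e * g (a+1) b c (e-1)
  + 2 * a * (b - q / 2) * (e - s) * g (a-1) b c (e+1)
  + 2 * (a - p) * b * (e - s / 2) * g (a+1) (b-1) c e
  - 2 * a * (b - q) * (e - s / 2) * g (a-1) (b+1) c e
  + 2 * (a - p / 2) * (b - q) * e * g a (b+1) c (e-1)
  - 2 * (a - p / 2) * b * (e - s) * g a (b-1) c (e+1)
noncomputable def T134 (p q s : ℝ) (g : Fun4) : Fun4 := fun a b c e =>
  -2 * (a - p) * (c - q / 2) * e * g (a+1) b c (e-1)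
  + 2 * a * (c - q / 2) * (e - s) * g (a-1) b c (e+1)
  + 2 * (a - p) * c * (e - s / 2) * g (a+1) b (c-1) e
  - 2 * a * (c - q) * (e - s / 2) * g (a-1) b (c+1) e
  + 2 * (a - p / 2) * (c - q) * e * g a b (c+1) (e-1)
  - 2 * (a - p / 2) * c * (e - s) * g a b (c-1) (e+1)
noncomputable def T123 (p q s : ℝ) (g : Fun4) : Fun4 := fun a b c e =>
  -2 * (a - p) * (b - q / 2) * c * g (a+1) b (c-1) e
  + 2 * a * (b - q / 2) * (c - s) * g (a-1) b (c+1) e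
  + 2 * (a - p) * b * (c - s / 2) * g (a+1) (b-1) c e
  - 2 * a * (b - q) * (c - s / 2) * g (a-1) (b+1) c e
  + 2 * (a - p / 2) * (b - q) * c * g a (b+1) (c-1) e
  - 2 * (a - p / 2) * b * (c - s) * g a (b-1) (c+1) e
noncomputable def T234 (p q s : ℝ) (g : Fun4) : Fun4 := fun a b c e =>
  -2 * (b - p) * (c - q / 2) * e * g a (b+1) c (e-1)
  + 2 * b * (c - q / 2) * (e - s) * g a (b-1) c (e+1)
  + 2 * (b - p) * c * (e - s / 2) * g a (b+1) (c-1) e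
  - 2 * b * (c - q) * (e - s / 2) * g a (b-1) (c+1) e
  + 2 * (b - p / 2) * (c - q) * e * g a b (c+1) (e-1)
  - 2 * (b - p / 2) * c * (e - s) * g a b (c-1) (e+1)

lemma T124_eq (p q s : ℝ) (g : Fun4) (a b c e : ℤ) :
    T124 p q s g a b c e = M12 p q (M24 q s g) a b c e - M24 q s (M12 p q g) a b c e := by
  simp only [T124, M12, M24, add_sub_cancel_right, sub_add_cancel]
  push_cast
  ring
lemma T134_eq (p q s : ℝ) (g : Fun4) (a b c e : ℤ) :
    T134 p q s g a b c e = M13 p q (M34 q s g) a b c e - M34 q s (M13 p q g) a b c e := by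
  simp only [T134, M13, M34, add_sub_cancel_right, sub_add_cancel]
  push_cast
  ring
lemma T123_eq (p q s : ℝ) (g : Fun4) (a b c e : ℤ) :
    T123 p q s g a b c e = M13 p s (M12 p q g) a b c e - M12 p q (M13 p s g) a b c e := by
  simp only [T123, M12, M13, add_sub_cancel_right, sub_add_cancel]
  push_cast
  ring
lemma T234_eq (p q s : ℝ) (g : Fun4) (a b c e : ℤ) :
    T234 p q s g a b c e = M34 q s (M24 p s g) a b c e - M24 p s (M34 q s g) a b c e := by
  simp only [T234, M34, M24, add_sub_cancel_right, sub_add_cancel]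
  push_cast
  ring

lemma Q_eq (p q r s : ℝ) (g : Fun4) (a b c e : ℤ) :
    M14 p s (M23 q r g) a b c e = M13 p r (M24 q s g) a b c e
      - (M34 r s (T124 p q s g) a b c e - T124 p q s (M34 r s g) a b c e) / 2 := by
  simp only [T124, M13, M24, M14, M23, M34, add_sub_cancel_right, sub_add_cancel]
  push_cast
  ring

set_option maxHeartbeats 4000000 in
lemma main_eq (p q r s : ℝ) (g : Fun4) (a b c e : ℤ) :
    2 * (p * (p + 2) / 2) * (s * (s + 2) / 2) * M23 q r g a b c e =
      T124 p q s (T134 p r s g) a b c e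
      + 2 * M14 p s (M23 q r (M14 p s g)) a b c e
      - 2 * M13 p r (M14 p s (M24 q s g)) a b c e
      - 2 * M12 p q (M14 p s (M34 r s g)) a b c e
      - s * (s + 2) * M12 p q (M13 p r g) a b c e
      - p * (p + 2) * M24 q s (M34 r s g) a b c e
      + 2 * T234 q r s (M14 p s g) a b c e
      - 2 * T134 p r s (M24 q s g) a b c e
      + 2 * T123 p q r (M14 p s g) a b c e
      - 2 * T124 p q s (M13 p r g) a b c e
      - 4 * M14 p s (M23 q r g) a b c e := by
  simp only [T124, T134, T234, T123, M12, M13, M24, M14, M23, M34, add_sub_cancel_right, sub_add_cancel]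
  push_cast
  ring

def emb4 {n : ℕ} (i j k l : Fin n) (x : Fin n → ℤ) (a b c e : ℤ) : Fin n → ℤ :=
  fun t => if t = i then a else if t = j then b else if t = k then c else if t = l then e else x t

def phi4 {n : ℕ} (i j k l : Fin n) (x : Fin n → ℤ) (f : (Fin n → ℤ) → ℝ) : Fun4 :=
  fun a b c e => f (emb4 i j k l x a b c e)

noncomputable def Pop (n : ℕ) (ℓ : Fin n → ℝ) (i j : Fin n) :
    Module.End ℝ ((Fin n → ℤ) → ℝ) := LopE n ℓ i j - algebraMap ℝ _ (ℓ i * ℓ j / 2)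

lemma Pop_apply (n : ℕ) (ℓ : Fin n → ℝ) (i j : Fin n) (f : (Fin n → ℤ) → ℝ) (x : Fin n → ℤ) :
    Pop n ℓ i j f x =
    (x j : ℝ) * ((x i : ℝ) - ℓ i) * (f (x + Pi.single i 1 - Pi.single j 1) - f x) +
      (x i : ℝ) * ((x j : ℝ) - ℓ j) * (f (x + Pi.single j 1 - Pi.single i 1) - f x)
      - ℓ i * ℓ j / 2 * f x := by
  simp [Pop, LopE, Module.algebraMap_end_apply]

section
variable {n : ℕ} (ℓ : Fin n → ℝ) {i j k l : Fin n} (hij : i ≠ j) (hik : i ≠ k) (hil : i ≠ l)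
  (hjk : j ≠ k) (hjl : j ≠ l) (hkl : k ≠ l) (x : Fin n → ℤ) (f : (Fin n → ℤ) → ℝ)

lemma phi12 (i j k l : Fin n) (hij : i ≠ j) (hik : i ≠ k) (hil : i ≠ l)
    (hjk : j ≠ k) (hjl : j ≠ l) (hkl : k ≠ l) :
    phi4 i j k l x (Pop n ℓ i j f) = M12 (ℓ i) (ℓ j) (phi4 i j k l x f) := by
  funext a b c e
  have h1 : emb4 i j k l x a b c e + Pi.single i 1 - Pi.single j 1 =
      emb4 i j k l x (a+1) (b-1) c e := by
    funext t; simp only [emb4, Pi.add_apply, Pi.sub_apply, Pi.single_apply]; grind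
  have h2 : emb4 i j k l x a b c e + Pi.single j 1 - Pi.single i 1 =
      emb4 i j k l x (a-1) (b+1) c e := by
    funext t; simp only [emb4, Pi.add_apply, Pi.sub_apply, Pi.single_apply]; grind
  have e1 : emb4 i j k l x a b c e i = a := by simp only [emb4]; grind
  have e2 : emb4 i j k l x a b c e j = b := by simp only [emb4]; grind
  simp only [phi4, Pop_apply, M12, h1, h2, e1, e2]
  ring

lemma emb_swap23 (i j k l : Fin n) (hij : i ≠ j) (hik : i ≠ k) (hil : i ≠ l)
    (hjk : j ≠ k) (hjl : j ≠ l) (hkl : k ≠ l) (a b c e : ℤ) :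
    emb4 i j k l x a b c e = emb4 i k j l x a c b e := by
  funext t; simp only [emb4]; grind

lemma phi13 (i j k l : Fin n) (hij : i ≠ j) (hik : i ≠ k) (hil : i ≠ l)
    (hjk : j ≠ k) (hjl : j ≠ l) (hkl : k ≠ l) :
    phi4 i j k l x (Pop n ℓ i k f) = M13 (ℓ i) (ℓ k) (phi4 i j k l x f) := by
  funext a b c e
  have h := congrFun (congrFun (congrFun (congrFun
    (phi12 ℓ x f i k j l hik hij hil hjk.symm hkl hjl) a) c) b) e
  have E : ∀ a b c e, emb4 i k j l x a c b e = emb4 i j k l x a b c e := by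
    intro a b c e; funext t; simp only [emb4]; grind
  simpa only [phi4, M12, M13, E] using h

lemma phi14 (i j k l : Fin n) (hij : i ≠ j) (hik : i ≠ k) (hil : i ≠ l)
    (hjk : j ≠ k) (hjl : j ≠ l) (hkl : k ≠ l) :
    phi4 i j k l x (Pop n ℓ i l f) = M14 (ℓ i) (ℓ l) (phi4 i j k l x f) := by
  funext a b c e
  have h := congrFun (congrFun (congrFun (congrFun
    (phi12 ℓ x f i l j k hil hij hik hjl.symm hkl.symm hjk) a) e) b) c
  have E : ∀ a b c e, emb4 i l j k x a e b c = emb4 i j k l x a b c e := by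
    intro a b c e; funext t; simp only [emb4]; grind
  simpa only [phi4, M12, M14, E] using h

lemma phi23 (i j k l : Fin n) (hij : i ≠ j) (hik : i ≠ k) (hil : i ≠ l)
    (hjk : j ≠ k) (hjl : j ≠ l) (hkl : k ≠ l) :
    phi4 i j k l x (Pop n ℓ j k f) = M23 (ℓ j) (ℓ k) (phi4 i j k l x f) := by
  funext a b c e
  have h := congrFun (congrFun (congrFun (congrFun
    (phi12 ℓ x f j k i l hjk hij.symm hjl hik.symm hkl hil) b) c) a) e
  have E : ∀ a b c e, emb4 j k i l x b c a e = emb4 i j k l x a b c e := by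
    intro a b c e; funext t; simp only [emb4]; grind
  simpa only [phi4, M12, M23, E] using h

lemma phi24 (i j k l : Fin n) (hij : i ≠ j) (hik : i ≠ k) (hil : i ≠ l)
    (hjk : j ≠ k) (hjl : j ≠ l) (hkl : k ≠ l) :
    phi4 i j k l x (Pop n ℓ j l f) = M24 (ℓ j) (ℓ l) (phi4 i j k l x f) := by
  funext a b c e
  have h := congrFun (congrFun (congrFun (congrFun
    (phi12 ℓ x f j l i k hjl hij.symm hjk hil.symm hkl.symm hik) b) e) a) c
  have E : ∀ a b c e, emb4 j l i k x b e a c = emb4 i j k l x a b c e := by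
    intro a b c e; funext t; simp only [emb4]; grind
  simpa only [phi4, M12, M24, E] using h

lemma phi34 (i j k l : Fin n) (hij : i ≠ j) (hik : i ≠ k) (hil : i ≠ l)
    (hjk : j ≠ k) (hjl : j ≠ l) (hkl : k ≠ l) :
    phi4 i j k l x (Pop n ℓ k l f) = M34 (ℓ k) (ℓ l) (phi4 i j k l x f) := by
  funext a b c e
  have h := congrFun (congrFun (congrFun (congrFun
    (phi12 ℓ x f k l i j hkl hik.symm hjk.symm hil.symm hjl.symm hij) c) e) a) b
  have E : ∀ a b c e, emb4 k l i j x c e a b = emb4 i j k l x a b c e := by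
    intro a b c e; funext t; simp only [emb4]; grind
  simpa only [phi4, M12, M34, E] using h

lemma phi_self (i j k l : Fin n) (h : (Fin n → ℤ) → ℝ) :
    phi4 i j k l x h (x i) (x j) (x k) (x l) = h x := by
  have : emb4 i j k l x (x i) (x j) (x k) (x l) = x := by
    funext t; simp only [emb4]; grind
  simp only [phi4, this]
end

theorem key {n : ℕ} (ℓ : Fin n → ℝ) (i j k l : Fin n) (hij : i ≠ j) (hik : i ≠ k) (hil : i ≠ l)
    (hjk : j ≠ k) (hjl : j ≠ l) (hkl : k ≠ l) (hi : ℓ i * (ℓ i + 2) ≠ 0)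
    (hl : ℓ l * (ℓ l + 2) ≠ 0)
    (B : Subalgebra ℝ (Module.End ℝ ((Fin n → ℤ) → ℝ)))
    (h12 : LopE n ℓ i j ∈ B) (h13 : LopE n ℓ i k ∈ B) (h14 : LopE n ℓ i l ∈ B)
    (h24 : LopE n ℓ j l ∈ B) (h34 : LopE n ℓ k l ∈ B) : LopE n ℓ j k ∈ B := by
  have hP : ∀ u v, LopE n ℓ u v ∈ B → Pop n ℓ u v ∈ B := fun u v h =>
    B.sub_mem h (B.algebraMap_mem _)
  suffices hh : Pop n ℓ j k ∈ B by
    have := B.add_mem hh (B.algebraMap_mem (ℓ j * ℓ k / 2))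
    simpa [Pop] using this
  replace h12 := hP _ _ h12
  replace h13 := hP _ _ h13
  replace h14 := hP _ _ h14
  replace h24 := hP _ _ h24
  replace h34 := hP _ _ h34
  clear hP
  have f12 := fun x f => phi12 ℓ x f i j k l hij hik hil hjk hjl hkl
  have f13 := fun x f => phi13 ℓ x f i j k l hij hik hil hjk hjl hkl
  have f14 := fun x f => phi14 ℓ x f i j k l hij hik hil hjk hjl hkl
  have f23 := fun x f => phi23 ℓ x f i j k l hij hik hil hjk hjl hkl
  have f24 := fun x f => phi24 ℓ x f i j k l hij hik hil hjk hjl hkl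
  have f34 := fun x f => phi34 ℓ x f i j k l hij hik hil hjk hjl hkl
  generalize Pop n ℓ i j = P12 at *
  generalize Pop n ℓ i k = P13 at *
  generalize Pop n ℓ i l = P14 at *
  generalize Pop n ℓ j k = P23 at *
  generalize Pop n ℓ j l = P24 at *
  generalize Pop n ℓ k l = P34 at *
  have psub : ∀ x f g, phi4 i j k l x (f - g) = phi4 i j k l x f - phi4 i j k l x g :=
    fun x f g => rfl
  obtain ⟨F124, hF124⟩ : ∃ F, F = P12 * P24 - P24 * P12 := ⟨_, rfl⟩
  obtain ⟨F134, hF134⟩ : ∃ F, F = P13 * P34 - P34 * P13 := ⟨_, rfl⟩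
  obtain ⟨F123, hF123⟩ : ∃ F, F = P13 * P12 - P12 * P13 := ⟨_, rfl⟩
  obtain ⟨F234, hF234⟩ : ∃ F, F = P34 * P24 - P24 * P34 := ⟨_, rfl⟩
  have t124 : ∀ x f, phi4 i j k l x (F124 f) = T124 (ℓ i) (ℓ j) (ℓ l) (phi4 i j k l x f) := by
    intro x f; funext a b c e
    rw [T124_eq, ← f24, ← f12, ← f12, ← f24, hF124]; rfl
  have t134 : ∀ x f, phi4 i j k l x (F134 f) = T134 (ℓ i) (ℓ k) (ℓ l) (phi4 i j k l x f) := by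
    intro x f; funext a b c e
    rw [T134_eq, ← f34, ← f13, ← f13, ← f34, hF134]; rfl
  have t123 : ∀ x f, phi4 i j k l x (F123 f) = T123 (ℓ i) (ℓ j) (ℓ k) (phi4 i j k l x f) := by
    intro x f; funext a b c e
    rw [T123_eq, ← f12, ← f13, ← f13, ← f12, hF123]; rfl
  have t234 : ∀ x f, phi4 i j k l x (F234 f) = T234 (ℓ j) (ℓ k) (ℓ l) (phi4 i j k l x f) := by
    intro x f; funext a b c e
    rw [T234_eq, ← f24, ← f34, ← f34, ← f24, hF234]; rfl
  have m124 : F124 ∈ B := hF124 ▸ B.sub_mem (B.mul_mem h12 h24) (B.mul_mem h24 h12)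
  have m134 : F134 ∈ B := hF134 ▸ B.sub_mem (B.mul_mem h13 h34) (B.mul_mem h34 h13)
  have m123 : F123 ∈ B := hF123 ▸ B.sub_mem (B.mul_mem h13 h12) (B.mul_mem h12 h13)
  have m234 : F234 ∈ B := hF234 ▸ B.sub_mem (B.mul_mem h34 h24) (B.mul_mem h24 h34)
  have hQ : P14 * P23 = P13 * P24 - (1/2 : ℝ) • (P34 * F124 - F124 * P34) := by
    ext f x
    have h := Q_eq (ℓ i) (ℓ j) (ℓ k) (ℓ l) (phi4 i j k l x f) (x i) (x j) (x k) (x l)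
    simp only [← t124, ← f12, ← f13, ← f14, ← f23, ← f24, ← f34, phi_self] at h
    simp only [Module.End.mul_apply, LinearMap.sub_apply, LinearMap.smul_apply, Pi.sub_apply,
      Pi.smul_apply, smul_eq_mul]
    linarith
  have mQ : P14 * P23 ∈ B := hQ ▸ B.sub_mem (B.mul_mem h13 h24)
    (B.smul_mem (B.sub_mem (B.mul_mem h34 m124) (B.mul_mem m124 h34)) _)
  have hM : (2 * (ℓ i * (ℓ i + 2) / 2) * (ℓ l * (ℓ l + 2) / 2)) • P23 =
      F124 * F134 + (2:ℝ) • (P14 * P23 * P14) - (2:ℝ) • (P13 * P14 * P24)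
      - (2:ℝ) • (P12 * P14 * P34) - (ℓ l * (ℓ l + 2)) • (P12 * P13)
      - (ℓ i * (ℓ i + 2)) • (P24 * P34) + (2:ℝ) • (F234 * P14) - (2:ℝ) • (F134 * P24)
      + (2:ℝ) • (F123 * P14) - (2:ℝ) • (F124 * P13) - (4:ℝ) • (P14 * P23) := by
    ext f x
    have h := main_eq (ℓ i) (ℓ j) (ℓ k) (ℓ l) (phi4 i j k l x f) (x i) (x j) (x k) (x l)
    simp only [← t124, ← t134, ← t123, ← t234, ← f12, ← f13, ← f14, ← f23, ← f24, ← f34,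
      phi_self] at h
    simp only [Module.End.mul_apply, LinearMap.sub_apply, LinearMap.add_apply,
      LinearMap.smul_apply, Pi.sub_apply, Pi.add_apply, Pi.smul_apply, smul_eq_mul]
    exact h
  have hne : 2 * (ℓ i * (ℓ i + 2) / 2) * (ℓ l * (ℓ l + 2) / 2) ≠ 0 :=
    mul_ne_zero (mul_ne_zero two_ne_zero (div_ne_zero hi two_ne_zero)) (div_ne_zero hl two_ne_zero)
  have mM : (2 * (ℓ i * (ℓ i + 2) / 2) * (ℓ l * (ℓ l + 2) / 2)) • P23 ∈ B := by
    rw [hM]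
    refine B.sub_mem (B.sub_mem (B.add_mem (B.sub_mem (B.add_mem (B.sub_mem (B.sub_mem
      (B.sub_mem (B.sub_mem (B.add_mem ?_ ?_) ?_) ?_) ?_) ?_) ?_) ?_) ?_) ?_) ?_
    · exact B.mul_mem m124 m134
    · exact B.smul_mem (B.mul_mem mQ h14) _
    · exact B.smul_mem (B.mul_mem (B.mul_mem h13 h14) h24) _
    · exact B.smul_mem (B.mul_mem (B.mul_mem h12 h14) h34) _
    · exact B.smul_mem (B.mul_mem h12 h13) _
    · exact B.smul_mem (B.mul_mem h24 h34) _
    · exact B.smul_mem (B.mul_mem m234 h14) _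
    · exact B.smul_mem (B.mul_mem m134 h24) _
    · exact B.smul_mem (B.mul_mem m123 h14) _
    · exact B.smul_mem (B.mul_mem m124 h13) _
    · exact B.smul_mem mQ _
  have := B.smul_mem mM (2 * (ℓ i * (ℓ i + 2) / 2) * (ℓ l * (ℓ l + 2) / 2))⁻¹
  rwa [smul_smul, inv_mul_cancel₀ hne, one_smul] at this

/-- The symmetry algebra, generated by all `L_{i,j}`, `1 ≤ i < j ≤ d+1`, is generated
by the `2d-1` operators `S = {L_{1,j} : j = 2,…,d} ∪ {L_{i,d+1} : i = 1,…,d}`. -/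
theorem stmt12 (d : ℕ) (hd : 2 ≤ d) (ℓ : Fin (d + 1) → ℝ)
    (hℓ : ∀ k, ℓ k * (ℓ k + 2) ≠ 0) :
    Algebra.adjoin ℝ
        {A : Module.End ℝ ((Fin (d + 1) → ℤ) → ℝ) |
          ∃ i j : Fin (d + 1), i < j ∧ A = LopE (d + 1) ℓ i j} =
      Algebra.adjoin ℝ
        ({A | ∃ j : Fin (d + 1), 0 < (j : ℕ) ∧ (j : ℕ) < d ∧ A = LopE (d + 1) ℓ 0 j} ∪
          {A | ∃ i : Fin (d + 1), (i : ℕ) < d ∧ A = LopE (d + 1) ℓ i (Fin.last d)}) := by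
  
  apply le_antisymm
  · apply Algebra.adjoin_le
    rintro A ⟨i, j, hij, rfl⟩
    rw [SetLike.mem_coe]
    set S := ({A | ∃ j : Fin (d + 1), 0 < (j : ℕ) ∧ (j : ℕ) < d ∧ A = LopE (d + 1) ℓ 0 j} ∪
          {A | ∃ i : Fin (d + 1), (i : ℕ) < d ∧ A = LopE (d + 1) ℓ i (Fin.last d)}) with hS
    have h0 : ∀ j : Fin (d + 1), 0 < (j : ℕ) → (j : ℕ) < d →
        LopE (d + 1) ℓ 0 j ∈ Algebra.adjoin ℝ S := fun j h h' =>
      Algebra.subset_adjoin (Or.inl ⟨j, h, h', rfl⟩)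
    have h1 : ∀ i : Fin (d + 1), (i : ℕ) < d →
        LopE (d + 1) ℓ i (Fin.last d) ∈ Algebra.adjoin ℝ S := fun i h =>
      Algebra.subset_adjoin (Or.inr ⟨i, h, rfl⟩)
    have hij' : (i : ℕ) < j := hij
    have hjd : (j : ℕ) < d + 1 := j.isLt
    by_cases hj : (j : ℕ) = d
    · obtain rfl : j = Fin.last d := Fin.ext hj
      exact h1 i (by omega)
    by_cases hi : (i : ℕ) = 0
    · obtain rfl : i = 0 := Fin.ext hi
      exact h0 j (by omega) (by omega)
    have z : ((0 : Fin (d + 1)) : ℕ) = 0 := rfl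
    have w : ((Fin.last d : Fin (d + 1)) : ℕ) = d := rfl
    refine key ℓ 0 i j (Fin.last d) ?_ ?_ ?_ ?_ ?_ ?_ (hℓ _) (hℓ _) _ (h0 i ?_ ?_) (h0 j ?_ ?_)
      (h1 0 ?_) (h1 i ?_) (h1 j ?_)
    all_goals first | omega | (rw [Ne, Fin.ext_iff]; omega)
  · apply Algebra.adjoin_le
    rintro A (⟨j, h, h', rfl⟩ | ⟨i, h, rfl⟩)
    · exact Algebra.subset_adjoin ⟨0, j, h, rfl⟩
    · exact Algebra.subset_adjoin ⟨i, Fin.last d, h, rfl⟩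
end
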